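/- arXiv:2205.03506 — 2 statements merged into one kernel-verified Lean document; each statement's English description precedes it below -/
import Mathlib

section
/- (Goldberg's theorem for m_3, existence part.) Let p, q be integers with q ≥ 1, 0 ≤ p < q and gcd(p,q) = 1, and let s₁ be an integer with 0 ≤ s₁ ≤ 2q. Then there exists a rotation set X for m_3 with rotation number ρ(X) = p/q (mod ℤ) which is the union of two distinct periodic orbits of m_3 and satisfies s₁(X) = s₁ (so that #X = 2q) if and only if s₁ is odd. -/
open Set MeasureTheory ENNReal

noncomputable section

instance : Fact ((0:ℝ) < 1) := ⟨one_pos⟩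

/-- The circle `ℝ/ℤ`. -/
abbrev Circle1 : Type := AddCircle (1 : ℝ)

/-- The multiplication-by-`d` map `m_d` on the circle. -/
def md (d : ℕ) : Circle1 → Circle1 := fun t => d • t

/-- `G : ℝ → ℝ` (monotone, commuting with `x ↦ x + 1`) is a lift of the circle map `g`. -/
def IsLift (g : Circle1 → Circle1) (G : CircleDeg1Lift) : Prop :=
  ∀ x : ℝ, g ((x : ℝ) : Circle1) = ((G x : ℝ) : Circle1)

/-- `g` is a monotone degree-one circle map. -/
def IsMonotoneDeg1 (g : Circle1 → Circle1) : Prop :=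
  ∃ G : CircleDeg1Lift, IsLift g G

/-- `ρ` is the rotation number of the monotone degree-one circle map `g`:
the residue class mod `ℤ` of the translation number of a lift of `g`. -/
def HasRotationNumber (g : Circle1 → Circle1) (ρ : Circle1) : Prop :=
  ∃ G : CircleDeg1Lift, IsLift g G ∧ ρ = ((G.translationNumber : ℝ) : Circle1)

/-- `X` is a rotation set for `m_d`. -/
def IsRotationSet (d : ℕ) (X : Set Circle1) : Prop :=
  X.Nonempty ∧ IsCompact X ∧ md d '' X = X ∧
    ∃ g : Circle1 → Circle1, IsMonotoneDeg1 g ∧ ∀ t ∈ X, g t = md d t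

/-- `X` is a rotation set for `m_d` with rotation number `ρ`. -/
def IsRotationSetWith (d : ℕ) (X : Set Circle1) (ρ : Circle1) : Prop :=
  X.Nonempty ∧ IsCompact X ∧ md d '' X = X ∧
    ∃ g : Circle1 → Circle1, (∀ t ∈ X, g t = md d t) ∧ HasRotationNumber g ρ

/-- A gap of `X` is a connected component of the complement of `X`. -/
def IsGap (X : Set Circle1) (I : Set Circle1) : Prop :=
  ∃ t ∈ Xᶜ, I = connectedComponentIn Xᶜ t

/-- `C` is a periodic orbit (cycle) of `m_d`. -/
def IsPeriodicOrbit (d : ℕ) (C : Set Circle1) : Prop :=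
  ∃ (t : Circle1) (n : ℕ), 0 < n ∧ (md d)^[n] t = t ∧
    C = Set.range (fun k : Fin n => (md d)^[(k : ℕ)] t)

/-- The number of points of `X` whose representative in `[0,1)` lies in `[0,1/2)`. -/
def s1 (X : Set Circle1) : ℕ :=
  {t ∈ X | ((AddCircle.equivIco 1 0 t : ℝ) < 1 / 2)}.ncard


theorem c1_eq_iff (a b : ℝ) : (a : Circle1) = (b : Circle1) ↔ ∃ n : ℤ, a = b + n := by
  rw [← sub_eq_zero, ← AddCircle.coe_sub, AddCircle.coe_eq_zero_iff]
  constructor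
  · rintro ⟨n, hn⟩
    refine ⟨n, ?_⟩
    simp at hn
    linarith
  · rintro ⟨n, hn⟩
    refine ⟨n, ?_⟩
    simp
    linarith

theorem md_coe (a : ℝ) : md 3 (a : Circle1) = ((3 * a : ℝ) : Circle1) := by
  unfold md
  rw [← AddCircle.coe_nsmul]
  simp

theorem per_mul {x : ℤ → ℝ} {N : ℤ} (hper : ∀ i, x (i + N) = x i + 1) (k : ℤ) :
    ∀ i, x (i + N * k) = x i + k := by
  induction k using Int.induction_on with
  | zero => simp
  | succ k ih =>
    intro i
    have := hper (i + N * k)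
    rw [ih] at this
    rw [show i + N * ((k : ℤ) + 1) = i + N * k + N by ring, this]
    push_cast; ring
  | pred k ih =>
    intro i
    have := hper (i + N * (-(k : ℤ) - 1))
    rw [show i + N * (-(k : ℤ) - 1) + N = i + N * (-k) by ring, ih] at this
    push_cast at this ⊢; linarith

theorem coe_x_eq {x : ℤ → ℝ} {N : ℤ} (hx : StrictMono x) (hper : ∀ i, x (i + N) = x i + 1)
    (i j : ℤ) : (x i : Circle1) = (x j : Circle1) ↔ ∃ k : ℤ, i = j + N * k := by
  rw [c1_eq_iff]
  constructor
  · rintro ⟨n, hn⟩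
    refine ⟨n, ?_⟩
    rw [← per_mul hper n j] at hn
    exact hx.injective hn
  · rintro ⟨n, rfl⟩
    exact ⟨n, per_mul hper n j⟩

theorem x_mem_Ico {x : ℤ → ℝ} {N : ℕ} (hx : StrictMono x)
    (hper : ∀ i, x (i + N) = x i + 1) (h0 : 0 ≤ x 0) (h1 : x (-1) < 0) (i : ℕ) (hi : i < N) :
    x i ∈ Ico (0 : ℝ) (0 + 1) := by
  constructor
  · exact h0.trans (hx.monotone (by positivity))
  · have : x i ≤ x (-1 + N) := hx.monotone (by omega)
    rw [hper] at this
    linarith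

theorem range_eq {x : ℤ → ℝ} {N : ℕ} (hN : 0 < N) (hx : StrictMono x)
    (hper : ∀ i, x (i + N) = x i + 1) :
    Set.range (fun i : ℤ => (x i : Circle1)) = (fun i : ℕ => (x i : Circle1)) '' (Set.Iio N) := by
  ext t
  constructor
  · rintro ⟨i, rfl⟩
    refine ⟨(i % N).toNat, ?_, ?_⟩
    · have := Int.emod_lt_of_pos i (show (0 : ℤ) < N by omega)
      have := Int.emod_nonneg i (show (N : ℤ) ≠ 0 by omega)
      simp only [Set.mem_Iio]; omega
    · simp only
      rw [coe_x_eq hx hper]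
      have := Int.emod_nonneg i (show (N : ℤ) ≠ 0 by omega)
      refine ⟨-(i / N), ?_⟩
      rw [Int.toNat_of_nonneg this]
      have := Int.emod_add_mul_ediv i N
      linarith
  · rintro ⟨i, -, rfl⟩
    exact ⟨i, rfl⟩

theorem injOn_x {x : ℤ → ℝ} {N : ℕ} (hx : StrictMono x)
    (hper : ∀ i, x (i + N) = x i + 1) (h0 : 0 ≤ x 0) (h1 : x (-1) < 0) :
    Set.InjOn (fun i : ℕ => (x i : Circle1)) (Set.Iio N) := by
  intro i hi j hj h
  simp only at h
  rw [AddCircle.coe_eq_coe_iff_of_mem_Ico (x_mem_Ico hx hper h0 h1 i hi)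
    (x_mem_Ico hx hper h0 h1 j hj)] at h
  exact_mod_cast hx.injective h

theorem ncard_x {x : ℤ → ℝ} {N : ℕ} (hN : 0 < N) (hx : StrictMono x)
    (hper : ∀ i, x (i + N) = x i + 1) (h0 : 0 ≤ x 0) (h1 : x (-1) < 0) :
    (Set.range (fun i : ℤ => (x i : Circle1))).ncard = N := by
  rw [range_eq hN hx hper, (injOn_x hx hper h0 h1).ncard_image]
  simp [Set.ncard_eq_toFinset_card']

theorem s1_x {x : ℤ → ℝ} {N : ℕ} (hN : 0 < N) (hx : StrictMono x)
    (hper : ∀ i, x (i + N) = x i + 1) (h0 : 0 ≤ x 0) (h1 : x (-1) < 0)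
    (s : ℕ) (hs : s ≤ N) (hlt : ∀ i : ℕ, i < N → (x i < 1 / 2 ↔ i < s)) :
    s1 (Set.range (fun i : ℤ => (x i : Circle1))) = s := by
  have : {t ∈ Set.range (fun i : ℤ => (x i : Circle1)) |
      ((AddCircle.equivIco 1 0 t : ℝ) < 1 / 2)} = (fun i : ℕ => (x i : Circle1)) '' (Set.Iio s) := by
    rw [range_eq hN hx hper]
    ext t
    constructor
    · rintro ⟨⟨i, hi, rfl⟩, h⟩
      simp only at h
      rw [AddCircle.equivIco_coe_of_mem (x_mem_Ico hx hper h0 h1 i hi)] at h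
      exact ⟨i, (hlt i hi).1 h, rfl⟩
    · rintro ⟨i, hi, rfl⟩
      have hi' : i < N := lt_of_lt_of_le hi hs
      refine ⟨⟨i, hi', rfl⟩, ?_⟩
      simp only
      rw [AddCircle.equivIco_coe_of_mem (x_mem_Ico hx hper h0 h1 i hi')]
      exact (hlt i hi').2 hi
  unfold s1
  rw [this, Set.InjOn.ncard_image]
  · simp [Set.ncard_eq_toFinset_card']
  · exact (injOn_x hx hper h0 h1).mono (fun i hi => lt_of_lt_of_le hi hs)

theorem exists_enum (X : Set Circle1) (N : ℕ) (hN : 0 < N) (hX : X.ncard = N) :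
    ∃ x : ℤ → ℝ, StrictMono x ∧ (∀ i, x (i + N) = x i + 1) ∧ 0 ≤ x 0 ∧ x (-1) < 0 ∧
      X = Set.range (fun i : ℤ => (x i : Circle1)) := by
  classical
  have hfin : X.Finite := Set.finite_of_ncard_pos (by omega)
  let F : Finset ℝ := hfin.toFinset.image (fun t => ((AddCircle.equivIco 1 0 t : Ico (0:ℝ) (0 + 1)) : ℝ))
  have hF : F.card = N := by
    rw [Finset.card_image_of_injective, ← hX, Set.ncard_eq_toFinset_card X hfin]
    intro a b h
    exact (AddCircle.equivIco (1:ℝ) 0).injective (Subtype.ext h)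
  let e := F.orderEmbOfFin hF
  have heF : ∀ k, e k ∈ F := fun k => F.orderEmbOfFin_mem hF k
  have heI : ∀ k, 0 ≤ e k ∧ e k < 1 := by
    intro k
    obtain ⟨t, -, ht⟩ := Finset.mem_image.1 (heF k)
    rw [← ht]
    have := (AddCircle.equivIco (1:ℝ) 0 t).2
    exact ⟨this.1, by simpa using this.2⟩
  have hN' : (0 : ℤ) < N := by omega
  have hlt : ∀ i : ℤ, (i % N).toNat < N := by
    intro i
    have := Int.emod_lt_of_pos i hN'
    omega
  let x : ℤ → ℝ := fun i => e ⟨(i % N).toNat, hlt i⟩ + (i / N : ℤ)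
  have hxs : StrictMono x := by
    intro i j hij
    have h1 : i / N ≤ j / N := Int.ediv_le_ediv hN' hij.le
    rcases h1.eq_or_lt with h | h
    · have : e ⟨(i % N).toNat, hlt i⟩ < e ⟨(j % N).toNat, hlt j⟩ := by
        apply e.strictMono
        simp only [Fin.mk_lt_mk]
        have h2 := Int.emod_add_mul_ediv i N
        have h3 := Int.emod_add_mul_ediv j N
        have h4 := Int.emod_nonneg i hN'.ne'
        rw [h] at h2
        omega
      simp only [x, h]
      linarith
    · have h2 : ((i / N : ℤ) : ℝ) + 1 ≤ (j / N : ℤ) := by exact_mod_cast h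
      have := heI ⟨(i % N).toNat, hlt i⟩
      have := heI ⟨(j % N).toNat, hlt j⟩
      simp only [x]
      linarith
  have hper : ∀ i, x (i + N) = x i + 1 := by
    intro i
    simp only [x]
    have h1 : (i + N) / (N : ℤ) = i / N + 1 := by
      rw [Int.add_ediv_of_dvd_right (dvd_refl _), Int.ediv_self hN'.ne']
    simp only [Int.add_emod_right, h1]
    push_cast; ring
  refine ⟨x, hxs, hper, ?_, ?_, ?_⟩
  · simp only [x]
    simp
    exact (heI _).1
  · have := hper (-1)
    have h2 : x (-1 + N) < 1 := by
      have h3 : (-1 + (N : ℤ)) / N = 0 := Int.ediv_eq_zero_of_lt (by omega) (by omega)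
      simp only [x, h3]
      simpa using (heI _).2
    linarith
  · ext t
    constructor
    · intro ht
      have : ((AddCircle.equivIco 1 0 t : Ico (0:ℝ) (0 + 1)) : ℝ) ∈ F :=
        Finset.mem_image.2 ⟨t, by simpa using ht, rfl⟩
      have h2 : ((AddCircle.equivIco 1 0 t : Ico (0:ℝ) (0 + 1)) : ℝ) ∈ Set.range e := by
        rw [Finset.range_orderEmbOfFin]; exact this
      obtain ⟨k, hk⟩ := h2
      refine ⟨(k : ℕ), ?_⟩
      have h3 : ((k : ℕ) : ℤ) / N = 0 := Int.ediv_eq_zero_of_lt (by omega) (by omega)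
      have h4 : ((k : ℕ) : ℤ) % N = (k : ℕ) := Int.emod_eq_of_lt (by omega) (by omega)
      simp only [x, h3, h4, Int.toNat_natCast, Fin.eta, hk]
      simp
    · rintro ⟨i, rfl⟩
      obtain ⟨t, ht, h⟩ := Finset.mem_image.1 (heF ⟨(i % N).toNat, hlt i⟩)
      have : ((x i : ℝ) : Circle1) = t := by
        rw [← AddCircle.coe_equivIco (p := (1:ℝ)) (a := 0) (y := t), c1_eq_iff]
        exact ⟨i / N, by simp only [x]; rw [← h]⟩
      simp only [this]
      simpa using ht

theorem c_per {x : ℤ → ℝ} {c : ℤ → ℤ} {N p : ℕ}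
    (hper : ∀ i, x (i + N) = x i + 1) (hrel : ∀ i, 3 * x i = c i + x (i + 2 * p)) (m i : ℤ) :
    c (i + N * m) = c i + 2 * m := by
  have h1 := hrel i
  have h2 := hrel (i + N * m)
  rw [show i + N * m + 2 * (p : ℤ) = i + 2 * p + N * m by ring, per_mul hper, per_mul hper] at h2
  have : (c (i + N * m) : ℝ) = c i + 2 * m := by linarith
  exact_mod_cast this

theorem c_bounds {x : ℤ → ℝ} {c : ℤ → ℤ} {q p : ℕ} (hpq : p < q) (hx : StrictMono x)
    (hper : ∀ i, x (i + (2 * q : ℕ)) = x i + 1) (hrel : ∀ i, 3 * x i = c i + x (i + 2 * p)) (i : ℤ) :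
    (c i : ℝ) ≤ 2 * x i ∧ 2 * x i < c i + 1 := by
  have h1 := hrel i
  have h2 : x i ≤ x (i + 2 * p) := hx.monotone (by omega)
  have h3 : x (i + 2 * p) < x (i + (2 * q : ℕ)) := hx (by push_cast; omega)
  rw [hper] at h3
  constructor <;> linarith

theorem nec_final {x : ℤ → ℝ} {c : ℤ → ℤ} {q p : ℕ} (hpq : p < q) (hx : StrictMono x)
    (hper : ∀ i, x (i + (2 * q : ℕ)) = x i + 1) (h0 : 0 ≤ x 0) (h1 : x (-1) < 0)
    (hrel : ∀ i, 3 * x i = c i + x (i + 2 * p)) :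
    Odd (s1 (Set.range (fun i : ℤ => (x i : Circle1)))) := by
  classical
  have hex : ∃ n : ℕ, 1 / 2 ≤ x n := ⟨(2 * q : ℕ), by
    have := hper 0
    rw [zero_add] at this
    rw [this]; linarith⟩
  have hsle : Nat.find hex ≤ 2 * q := Nat.find_min' hex (by
    have := hper 0
    rw [zero_add] at this
    rw [this]; linarith)
  have hiff : ∀ i : ℕ, x i < 1 / 2 ↔ i < Nat.find hex := by
    intro i
    rw [Nat.lt_find_iff]
    constructor
    · intro h m hm
      have : x m ≤ x i := hx.monotone (by exact_mod_cast hm)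
      linarith
    · intro h
      exact not_le.1 (h i le_rfl)
  obtain ⟨s, hs⟩ : ∃ s, s = Nat.find hex := ⟨_, rfl⟩
  rw [← hs] at hsle hiff
  rw [s1_x (by omega) hx hper h0 h1 s hsle (fun i _ => hiff i)]
  by_contra hodd
  rw [Nat.not_odd_iff_even] at hodd
  obtain ⟨k, hk⟩ := hodd
  have hc0 : ∀ i : ℕ, i < 2 * q → (c i = if i < s then 0 else 1) := by
    intro i hi
    have hb := c_bounds hpq hx hper hrel i
    have hI := x_mem_Ico hx hper h0 h1 i hi
    have hI1 := hI.1
    have hI2 : x i < 1 := by simpa using hI.2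
    split_ifs with h
    · have h3 := (hiff i).2 h
      have h4 : (c i : ℝ) < 1 := by linarith
      have h5 : (-1 : ℝ) < c i := by linarith
      have h4' : c i < 1 := by exact_mod_cast h4
      have h5' : -1 < c i := by exact_mod_cast h5
      omega
    · have h3 := not_lt.1 (fun h' => h ((hiff i).1 h'))
      have h4 : (c i : ℝ) < 2 := by linarith
      have h5 : (0 : ℝ) < c i := by linarith
      have h4' : c i < 2 := by exact_mod_cast h4
      have h5' : 0 < c i := by exact_mod_cast h5
      omega
  have hceq : ∀ i : ℤ, c (2 * i) = c (2 * i + 1) := by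
    intro i
    have hq : (0 : ℤ) < q := by omega
    have e1 := Int.emod_add_mul_ediv i q
    have e2 := Int.emod_nonneg i hq.ne'
    have e3 := Int.emod_lt_of_pos i hq
    obtain ⟨r, hr⟩ := Int.eq_ofNat_of_zero_le e2
    rw [hr] at e1 e3
    have f1 : 2 * i = ((2 * r : ℕ) : ℤ) + (2 * q : ℕ) * (i / q) := by
      push_cast; linarith
    have f2 : 2 * i + 1 = ((2 * r + 1 : ℕ) : ℤ) + (2 * q : ℕ) * (i / q) := by
      push_cast; linarith
    rw [f2, f1, c_per hper hrel, c_per hper hrel, hc0 _ (by omega), hc0 _ (by omega)]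
    congr 1
    split_ifs <;> omega
  have hd : ∀ n : ℕ, 3 ^ n * (x 1 - x 0) = x (2 * (p * n) + 1) - x (2 * (p * n)) := by
    intro n
    induction n with
    | zero => simp
    | succ n ih =>
      have r1 := hrel (2 * (p * n) + 1)
      have r2 := hrel (2 * (p * n))
      rw [hceq] at r2
      rw [pow_succ, mul_right_comm, ih]
      rw [show 2 * ((p : ℤ) * n) + 1 + 2 * p = 2 * (p * ((n + 1 : ℕ) : ℤ)) + 1 by push_cast; ring] at r1
      rw [show 2 * ((p : ℤ) * n) + 2 * p = 2 * (p * ((n + 1 : ℕ) : ℤ)) by push_cast; ring] at r2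
      linarith
  have hdq := hd q
  have hp1 := per_mul hper p 1
  have hp0 := per_mul hper p 0
  rw [show 1 + ((2 * q : ℕ) : ℤ) * p = 2 * (p * q) + 1 by push_cast; ring] at hp1
  rw [show 0 + ((2 * q : ℕ) : ℤ) * p = 2 * (p * q) by push_cast; ring] at hp0
  rw [hp1, hp0] at hdq
  have hpos : x 0 < x 1 := hx (by norm_num)
  have h3 : (1 : ℝ) < 3 ^ q := one_lt_pow₀ (by norm_num) (by omega)
  nlinarith

theorem nec (p q : ℕ) (hpq : p < q) (X : Set Circle1)
    (hX : IsRotationSetWith 3 X ((((p : ℝ) / (q : ℝ)) : ℝ) : Circle1))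
    (hcard : X.ncard = 2 * q) : Odd (s1 X) := by
  obtain ⟨x, hx, hper, h0, h1, rfl⟩ := exists_enum X (2 * q) (by omega) hcard
  obtain ⟨-, -, himg, g, hg, G, hG, hρ⟩ := hX
  have hfin : (Set.range (fun i : ℤ => (x i : Circle1))).Finite :=
    Set.finite_of_ncard_pos (by omega)
  have hinj : Set.InjOn (md 3) (Set.range (fun i : ℤ => (x i : Circle1))) :=
    Set.injOn_of_ncard_image_eq (by rw [himg]) hfin
  have hmdG : ∀ i, md 3 (x i : Circle1) = (G (x i) : Circle1) := by
    intro i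
    rw [← hg _ ⟨i, rfl⟩, hG]
  have hσ : ∀ i, ∃ j, G (x i) = x j := by
    intro i
    have : md 3 (x i : Circle1) ∈ Set.range (fun i : ℤ => (x i : Circle1)) := by
      have := Set.mem_image_of_mem (md 3) (show (x i : Circle1) ∈ Set.range (fun i : ℤ => (x i : Circle1)) from ⟨i, rfl⟩)
      rwa [himg] at this
    obtain ⟨j, hj⟩ := this
    simp only at hj
    rw [hmdG, eq_comm, c1_eq_iff] at hj
    obtain ⟨n, hn⟩ := hj
    exact ⟨j + (2 * q : ℕ) * n, by rw [per_mul hper, hn]⟩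
  choose σ hσ using hσ
  have hσper : ∀ i k, σ (i + (2 * q : ℕ) * k) = σ i + (2 * q : ℕ) * k := by
    intro i k
    apply hx.injective
    rw [← hσ, per_mul hper, per_mul hper, ← hσ, G.map_add_int]
  have hσmono : Monotone σ := by
    intro i j hij
    rw [← hx.le_iff_le, ← hσ, ← hσ]
    exact G.monotone (hx.monotone hij)
  have hσinj : Function.Injective σ := by
    intro i j hij
    have : md 3 (x i : Circle1) = md 3 (x j : Circle1) := by
      rw [hmdG, hmdG, hσ, hσ, hij]
    have := hinj ⟨i, rfl⟩ ⟨j, rfl⟩ this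
    rw [coe_x_eq hx hper] at this
    obtain ⟨k, rfl⟩ := this
    rw [hσper] at hij
    omega
  have hσs : StrictMono σ := hσmono.strictMono_of_injective hσinj
  have hf : Monotone (fun i => σ i - i) := by
    apply monotone_int_of_le_succ
    intro n
    have := hσs (show n < n + 1 by omega)
    omega
  have hstep : ∀ i, σ (i + 1) = σ i + 1 := by
    intro i
    have a1 := hf (show i ≤ i + 1 by omega)
    have a2 := hf (show i + 1 ≤ i + (2 * q : ℕ) * 1 by push_cast; omega)
    simp only [hσper] at a1 a2
    omega
  have hσr : ∀ i, σ i = i + σ 0 := by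
    intro i
    induction i using Int.induction_on with
    | zero => simp
    | succ k ih => rw [hstep, ih]; ring
    | pred k ih =>
      have := hstep (-(k : ℤ) - 1)
      rw [sub_add_cancel, ih] at this
      omega
  have hiter : ∀ n : ℕ, (G ^ n) (x 0) = x (σ 0 * n) := by
    intro n
    induction n with
    | zero => simp
    | succ n ih =>
      rw [pow_succ', CircleDeg1Lift.mul_apply, ih, hσ, hσr]
      congr 1
      push_cast; ring
  have hτ : G.translationNumber = (σ 0 : ℝ) / ((2 * q : ℕ) : ℝ) := by
    apply CircleDeg1Lift.translationNumber_of_map_pow_eq_add_int (x := x 0) _ _ (by omega)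
    rw [hiter, ← per_mul hper]
    congr 1
    ring
  rw [hτ, c1_eq_iff] at hρ
  obtain ⟨n, hn⟩ := hρ
  have hq0 : (q : ℝ) ≠ 0 := by
    have : q ≠ 0 := by omega
    exact_mod_cast this
  push_cast at hn
  field_simp at hn
  have hn' : (p : ℤ) * 2 = σ 0 + q * 2 * n := by
    have : (p : ℝ) * 2 = σ 0 + q * 2 * n := by linarith
    exact_mod_cast this
  have hc : ∀ i, ∃ c : ℤ, 3 * x i = c + x (i + 2 * p) := by
    intro i
    have := hmdG i
    rw [md_coe, c1_eq_iff] at this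
    obtain ⟨m, hm⟩ := this
    refine ⟨m - n, ?_⟩
    rw [hm, hσ, hσr, show i + 2 * (p : ℤ) = i + σ 0 + (2 * q : ℕ) * n by push_cast; linarith,
      per_mul hper]
    push_cast; ring
  choose c hc using hc
  exact nec_final hpq hx hper h0 h1 hc

theorem exists_lift {x : ℤ → ℝ} {N : ℕ} (hN : 0 < N) (hx : StrictMono x)
    (hper : ∀ i, x (i + N) = x i + 1) (r : ℤ) :
    ∃ G : CircleDeg1Lift, ∀ i, G (x i) = x (i + r) := by
  have hN' : (0 : ℤ) < N := by omega
  have hgr : ∀ y : ℝ, ∃ k : ℤ, x k ≤ y ∧ ∀ j, x j ≤ y → j ≤ k := by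
    intro y
    apply Int.exists_greatest_of_bdd (P := fun k => x k ≤ y)
    · refine ⟨0 + N * (⌈y - x 0⌉), fun z hz => ?_⟩
      rw [← hx.le_iff_le, per_mul hper]
      have := Int.le_ceil (y - x 0)
      linarith
    · refine ⟨0 + N * (⌊y - x 0⌋), ?_⟩
      rw [per_mul hper]
      have := Int.floor_le (y - x 0)
      linarith
  choose ν hν1 hν2 using hgr
  have hνx : ∀ i, ν (x i) = i := fun i =>
    le_antisymm (hx.le_iff_le.1 (hν1 _)) (hν2 _ _ le_rfl)
  have hνp : ∀ y, ν (y + 1) = ν y + N := by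
    intro y
    apply le_antisymm
    · have h := hν1 (y + 1)
      have h2 := hper (ν (y + 1) - N)
      rw [sub_add_cancel] at h2
      have := hν2 y (ν (y + 1) - N) (by linarith)
      omega
    · apply hν2
      rw [hper]
      linarith [hν1 y]
  refine ⟨⟨⟨fun y => x (ν y + r), ?_⟩, ?_⟩, ?_⟩
  · intro y z hyz
    apply hx.monotone
    have := hν2 z (ν y) ((hν1 y).trans hyz)
    omega
  · intro y
    simp only
    rw [hνp, ← hper]
    congr 1
    ring
  · intro i
    show x (ν (x i) + r) = _
    rw [hνx]

theorem isLift_of (G : CircleDeg1Lift) :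
    IsLift (fun t => ((G (AddCircle.equivIco (1:ℝ) 0 t : ℝ) : ℝ) : Circle1)) G := by
  intro y
  simp only
  have : ((AddCircle.equivIco (1:ℝ) 0 (y : Circle1) : ℝ) : Circle1) = y := AddCircle.coe_equivIco
  rw [c1_eq_iff] at this ⊢
  obtain ⟨n, hn⟩ := this
  exact ⟨n, by rw [hn, G.map_add_int]⟩

theorem md_x {x : ℤ → ℝ} {c : ℤ → ℤ} {p : ℕ} (hrel : ∀ i, 3 * x i = c i + x (i + 2 * p)) (i : ℤ) :
    md 3 (x i : Circle1) = (x (i + 2 * p) : Circle1) := by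
  rw [md_coe, c1_eq_iff]
  exact ⟨c i, by rw [hrel]; ring⟩

theorem md_iter {x : ℤ → ℝ} {c : ℤ → ℤ} {p : ℕ} (hrel : ∀ i, 3 * x i = c i + x (i + 2 * p)) (i : ℤ)
    (n : ℕ) : (md 3)^[n] (x i : Circle1) = (x (i + 2 * p * n) : Circle1) := by
  induction n with
  | zero => simp
  | succ n ih =>
    rw [Function.iterate_succ_apply', ih, md_x hrel]
    congr 2
    push_cast; ring

theorem exists_mul_mod {p q : ℕ} (hq : 0 < q) (hcop : Nat.Coprime p q) (a : ℤ) :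
    ∃ j : ℕ, j < q ∧ ∃ m : ℤ, (p : ℤ) * j = a + q * m := by
  have hb := Nat.gcd_eq_gcd_ab p q
  rw [hcop.gcd_eq_one] at hb
  have hq' : (0 : ℤ) < q := by omega
  have e1 := Int.emod_add_mul_ediv (a * Nat.gcdA p q) q
  have e2 := Int.emod_nonneg (a * Nat.gcdA p q) hq'.ne'
  have e3 := Int.emod_lt_of_pos (a * Nat.gcdA p q) hq'
  obtain ⟨r, hr⟩ := Int.eq_ofNat_of_zero_le e2
  rw [hr] at e1 e3
  refine ⟨r, by omega, -(a * Nat.gcdB p q) - p * (a * Nat.gcdA p q / q), ?_⟩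
  have : (r : ℤ) = a * Nat.gcdA p q - q * (a * Nat.gcdA p q / q) := by linarith
  rw [this]
  push_cast at hb
  linear_combination (-a) * hb

def TT (c : ℤ → ℤ) (p : ℤ) : ℕ → ℤ → ℤ
  | 0, _ => 0
  | (n + 1), i => 3 * TT c p n i + c (i + 2 * p * n)

theorem TT_succ' (c : ℤ → ℤ) (p : ℤ) (n : ℕ) (i : ℤ) :
    TT c p (n + 1) i = 3 ^ n * c i + TT c p n (i + 2 * p) := by
  induction n generalizing i with
  | zero => simp [TT]
  | succ n ih =>
    rw [TT, ih, TT]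
    rw [show i + 2 * p * ((n + 1 : ℕ) : ℤ) = i + 2 * p + 2 * p * n by push_cast; ring]
    ring

theorem TT_mono {c : ℤ → ℤ} (hc : Monotone c) (p : ℤ) (n : ℕ) (i : ℤ) :
    TT c p n i ≤ TT c p n (i + 1) := by
  induction n with
  | zero => simp [TT]
  | succ n ih =>
    simp only [TT]
    have := hc (show i + 2 * p * n ≤ i + 1 + 2 * p * n by omega)
    omega

theorem TT_strict {c : ℤ → ℤ} (hc : Monotone c) (p : ℤ) (n : ℕ) (i : ℤ)
    (h : ∃ j : ℕ, j < n ∧ c (i + 2 * p * j) < c (i + 1 + 2 * p * j)) :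
    TT c p n i < TT c p n (i + 1) := by
  induction n with
  | zero => obtain ⟨j, hj, -⟩ := h; omega
  | succ n ih =>
    obtain ⟨j, hj, hlt⟩ := h
    simp only [TT]
    rcases Nat.lt_succ_iff_lt_or_eq.1 hj with h' | rfl
    · have := ih ⟨j, h', hlt⟩
      have := hc (show i + 2 * p * n ≤ i + 1 + 2 * p * n by omega)
      omega
    · have := TT_mono hc p j i
      omega

theorem TT_per {c : ℤ → ℤ} {N : ℤ} (hc : ∀ i, c (i + N) = c i + 2) (p : ℤ) (n : ℕ) (i : ℤ) :
    TT c p n (i + N) = TT c p n i + (3 ^ n - 1) := by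
  induction n with
  | zero => simp [TT]
  | succ n ih =>
    simp only [TT, ih]
    rw [show i + N + 2 * p * n = i + 2 * p * n + N by ring, hc]
    ring

theorem suf_x (p q k : ℕ) (hq : 0 < q) (hcop : Nat.Coprime p q) (hk : k < q) :
    ∃ (x : ℤ → ℝ) (c : ℤ → ℤ), StrictMono x ∧ (∀ i, x (i + (2 * q : ℕ)) = x i + 1) ∧
      (∀ i, 3 * x i = c i + x (i + 2 * p)) ∧ c (-1) = -1 ∧
      ∀ i : ℕ, i < 2 * q → c i = if i < 2 * k + 1 then 0 else 1 := by
  obtain ⟨N, hN⟩ : ∃ N : ℤ, N = (2 * q : ℕ) := ⟨_, rfl⟩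
  have hNpos : 0 < N := by omega
  let c : ℤ → ℤ := fun i => 2 * (i / N) + if i % N < 2 * k + 1 then 0 else 1
  have hcper : ∀ i, c (i + N) = c i + 2 := by
    intro i
    simp only [c]
    rw [Int.add_ediv_of_dvd_right (dvd_refl _), Int.ediv_self hNpos.ne', Int.add_emod_right]
    ring
  have hcperm : ∀ m i : ℤ, c (i + N * m) = c i + 2 * m := by
    intro m i
    simp only [c]
    rw [Int.add_mul_ediv_left _ _ hNpos.ne', Int.add_mul_emod_self_left]
    ring
  have hcr : ∀ i : ℤ, 0 ≤ i → i < N → c i = if i < 2 * k + 1 then 0 else 1 := by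
    intro i h1 h2
    simp only [c]
    rw [Int.ediv_eq_zero_of_lt h1 h2, Int.emod_eq_of_lt h1 h2]
    ring
  have hcm1 : c (-1) = -1 := by
    have := hcper (-1)
    rw [hcr _ (by omega) (by omega), if_neg (by omega)] at this
    omega
  have hcmono : Monotone c := by
    intro i j hij
    simp only [c]
    have h1 : i / N ≤ j / N := Int.ediv_le_ediv hNpos hij
    rcases h1.eq_or_lt with h | h
    · have h2 := Int.emod_add_mul_ediv i N
      have h3 := Int.emod_add_mul_ediv j N
      rw [h] at h2 ⊢
      split_ifs <;> omega
    · split_ifs <;> omega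
  have h3q : (1 : ℝ) < 3 ^ q := one_lt_pow₀ (by norm_num) (by omega)
  have h3ne : (3 : ℝ) ^ q - 1 ≠ 0 := by linarith
  have hjump : ∀ i : ℤ, ∃ j : ℕ, j < q ∧ c (i + 2 * p * j) < c (i + 1 + 2 * p * j) := by
    intro i
    rcases Int.even_or_odd' i with ⟨a, rfl | rfl⟩
    · obtain ⟨j, hj, m, hm⟩ := exists_mul_mod hq hcop (k - a)
      refine ⟨j, hj, ?_⟩
      have e1 : 2 * a + 2 * (p : ℤ) * j = 2 * k + N * m := by
        rw [hN]; push_cast; linear_combination 2 * hm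
      have e2 : 2 * a + 1 + 2 * (p : ℤ) * j = 2 * k + 1 + N * m := by
        rw [hN]; push_cast; linear_combination 2 * hm
      rw [e1, e2, hcperm, hcperm, hcr _ (by omega) (by omega), hcr _ (by omega) (by omega),
        if_pos (by omega), if_neg (by omega)]
      omega
    · obtain ⟨j, hj, m, hm⟩ := exists_mul_mod hq hcop (-1 - a)
      refine ⟨j, hj, ?_⟩
      have e1 : 2 * a + 1 + 2 * (p : ℤ) * j = -1 + N * m := by
        rw [hN]; push_cast; linear_combination 2 * hm
      have e2 : 2 * a + 1 + 1 + 2 * (p : ℤ) * j = 0 + N * m := by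
        rw [hN]; push_cast; linear_combination 2 * hm
      rw [e1, e2, hcperm, hcperm, hcr 0 (by omega) (by omega), hcm1, if_pos (by omega)]
      omega
  refine ⟨fun i => ((TT c p q i : ℝ) + p) / (3 ^ q - 1), c, ?_, ?_, ?_, hcm1, ?_⟩
  · apply strictMono_int_of_lt_succ
    intro i
    apply div_lt_div_of_pos_right _ (by linarith)
    have := TT_strict hcmono p q i (hjump i)
    have : (TT c p q i : ℝ) < TT c p q (i + 1) := by exact_mod_cast this
    linarith
  · intro i
    have := TT_per hcper p q i
    simp only
    rw [← hN, this]
    push_cast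
    field_simp
    ring
  · intro i
    have h1 := TT_succ' c p q i
    rw [TT, show i + 2 * (p : ℤ) * q = i + N * p by rw [hN]; push_cast; ring, hcperm] at h1
    have h2 : 3 * (TT c p q i : ℝ) + (c i + 2 * p) = 3 ^ q * c i + TT c p q (i + 2 * p) := by
      exact_mod_cast h1
    field_simp
    linarith
  · intro i hi
    rw [hcr i (by omega) (by omega)]
    split_ifs <;> omega

theorem suf (p q k : ℕ) (hpq : p < q) (hcop : Nat.Coprime p q) (hk : k < q) :
    ∃ X : Set Circle1,
        IsRotationSetWith 3 X ((((p : ℝ) / (q : ℝ)) : ℝ) : Circle1) ∧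
        (∃ C C' : Set Circle1, IsPeriodicOrbit 3 C ∧ IsPeriodicOrbit 3 C' ∧
          C ≠ C' ∧ X = C ∪ C') ∧
        X.ncard = 2 * q ∧ s1 X = 2 * k + 1 := by
  have hq : 0 < q := by omega
  obtain ⟨x, c, hx, hper, hrel, hcm1, hc⟩ := suf_x p q k hq hcop hk
  have hb := c_bounds hpq hx hper hrel
  have h0 : 0 ≤ x 0 := by
    have h := hc 0 (by omega)
    rw [if_pos (by omega)] at h
    have h2 := (hb 0).1
    simp only [Nat.cast_zero] at h
    rw [h] at h2
    push_cast at h2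
    linarith
  have h1 : x (-1) < 0 := by
    have h2 := (hb (-1)).2
    rw [hcm1] at h2
    push_cast at h2
    linarith
  have hncard := ncard_x (by omega) hx hper h0 h1
  have hfin : (Set.range (fun i : ℤ => (x i : Circle1))).Finite :=
    Set.finite_of_ncard_pos (by omega)
  have horb : ∀ i : ℤ, IsPeriodicOrbit 3
      (Set.range (fun j : Fin q => (md 3)^[(j : ℕ)] (x i : Circle1))) := by
    intro i
    refine ⟨x i, q, hq, ?_, rfl⟩
    rw [md_iter hrel, coe_x_eq hx hper]
    exact ⟨p, by push_cast; ring⟩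
  refine ⟨Set.range (fun i : ℤ => (x i : Circle1)), ⟨⟨_, 0, rfl⟩, hfin.isCompact, ?_, ?_⟩,
    ⟨_, _, horb 0, horb 1, ?_, ?_⟩, hncard, ?_⟩
  · ext t
    constructor
    · rintro ⟨_, ⟨i, rfl⟩, rfl⟩
      exact ⟨i + 2 * p, (md_x hrel i).symm⟩
    · rintro ⟨i, rfl⟩
      refine ⟨_, ⟨i - 2 * p, rfl⟩, ?_⟩
      simp only
      rw [md_x hrel, sub_add_cancel]
  · obtain ⟨G, hG⟩ := exists_lift (by omega) hx hper (2 * p)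
    have hl := isLift_of G
    refine ⟨_, ?_, G, hl, ?_⟩
    · rintro _ ⟨i, rfl⟩
      have := hl (x i)
      simp only at this ⊢
      rw [this, md_x hrel, hG]
    · have hiter : ∀ n : ℕ, (G ^ n) (x 0) = x (2 * p * n) := by
        intro n
        induction n with
        | zero => simp
        | succ n ih =>
          rw [pow_succ', CircleDeg1Lift.mul_apply, ih, hG]
          congr 1
      have : G.translationNumber = ((p : ℤ) : ℝ) / (q : ℝ) := by
        apply CircleDeg1Lift.translationNumber_of_map_pow_eq_add_int (x := x 0) _ _ hq
        rw [hiter, ← per_mul hper]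
        congr 1
        push_cast; ring
      rw [this]
      simp
  · intro h
    have : (x 1 : Circle1) ∈ Set.range (fun j : Fin q => (md 3)^[(j : ℕ)] (x 0 : Circle1)) := by
      rw [h]
      exact ⟨⟨0, hq⟩, rfl⟩
    obtain ⟨j, hj⟩ := this
    simp only at hj
    rw [md_iter hrel, coe_x_eq hx hper] at hj
    obtain ⟨m, hm⟩ := hj
    push_cast at hm
    have : 2 * ((p : ℤ) * j - q * m) = 1 := by linear_combination hm
    omega
  · ext t
    constructor
    · rintro ⟨i, rfl⟩
      rcases Int.even_or_odd' i with ⟨a, rfl | rfl⟩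
      · left
        obtain ⟨j, hj, m, hm⟩ := exists_mul_mod hq hcop a
        refine ⟨⟨j, hj⟩, ?_⟩
        simp only
        rw [md_iter hrel, coe_x_eq hx hper]
        exact ⟨m, by push_cast; linear_combination 2 * hm⟩
      · right
        obtain ⟨j, hj, m, hm⟩ := exists_mul_mod hq hcop a
        refine ⟨⟨j, hj⟩, ?_⟩
        simp only
        rw [md_iter hrel, coe_x_eq hx hper]
        exact ⟨m, by push_cast; linear_combination 2 * hm⟩
    · rintro (⟨j, rfl⟩ | ⟨j, rfl⟩)
      · exact ⟨_, (md_iter hrel 0 j).symm⟩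
      · exact ⟨_, (md_iter hrel 1 j).symm⟩
  · apply s1_x (by omega) hx hper h0 h1 _ (by omega)
    intro i hi
    have h := hc i hi
    have hbi := hb i
    constructor
    · intro hlt
      by_contra hn
      rw [if_neg hn] at h
      rw [h] at hbi
      push_cast at hbi
      linarith
    · intro hlt
      rw [if_pos hlt] at h
      rw [h] at hbi
      push_cast at hbi
      linarith

/-- Goldberg, existence. For reduced `p/q` and `0 ≤ s₁ ≤ 2q`, there is a
rotation set for `m_3` with rotation number `p/q`, being the union of two distinct periodic
orbits, with `2q` elements and exactly `s₁` of them in `[0,1/2)`, if and only if `s₁` is odd. -/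
theorem goldberg_existence_m3
    (p q : ℕ) (hq : 1 ≤ q) (hpq : p < q) (hcop : Nat.Coprime p q)
    (s₁ : ℕ) (hs₁ : s₁ ≤ 2 * q) :
    (∃ X : Set Circle1,
        IsRotationSetWith 3 X ((((p : ℝ) / (q : ℝ)) : ℝ) : Circle1) ∧
        (∃ C C' : Set Circle1, IsPeriodicOrbit 3 C ∧ IsPeriodicOrbit 3 C' ∧
          C ≠ C' ∧ X = C ∪ C') ∧
        X.ncard = 2 * q ∧ s1 X = s₁) ↔ Odd s₁ := by
  constructor
  · rintro ⟨X, hX, -, hcard, rfl⟩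
    exact nec p q hpq X hX hcard
  · rintro ⟨k, rfl⟩
    exact suf p q k hpq hcop (by omega)
end
end

section
/- (Goldberg's theorem for m_2.) Let p, q be integers with q ≥ 1, 0 ≤ p < q and gcd(p,q) = 1. Then there is exactly one periodic orbit of m_2 on 𝕋 which, as a set, is a rotation set for m_2 with rotation number p/q (mod ℤ); moreover this periodic orbit has exactly q elements. -/
open Set MeasureTheory ENNReal

noncomputable section

lemma gb_jump (p q : ℕ) (hq : 0 < q) (y : ℕ → ℝ) (hmono : ∀ j, y j < y (j+1))
    (hper : ∀ j, y (j+q) = y j + 1) (b : ℕ → ℤ) (hb : ∀ j, 2 * y j - y (j+p) = b j) :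
    ∃ j1 : ℕ, ∀ i, b (j1 + i) = b j1 + ((i / q : ℕ) : ℤ) := by
  have hsm : StrictMono y := strictMono_nat_of_lt_succ hmono
  have hbm : Monotone b := by
    refine monotone_nat_of_le_succ fun j => ?_
    have h1 := hb j
    have h2 := hb (j+1)
    have h3 := hmono j
    have h4 : y (j + 1 + p) ≤ y (j + p) + 1 := by
      rw [← hper]; exact hsm.monotone (by omega)
    have : (b j : ℝ) - 1 < b (j+1) := by rw [← h1, ← h2]; linarith
    have : b j - 1 < b (j+1) := by exact_mod_cast this
    omega
  have hbq : ∀ j, b (j+q) = b j + 1 := by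
    intro j
    have h1 := hb j
    have h2 := hb (j+q)
    rw [show j + q + p = (j+p) + q by ring, hper, hper] at h2
    have : (b (j+q) : ℝ) = b j + 1 := by rw [← h1, ← h2]; ring
    exact_mod_cast this
  obtain ⟨j0, hj0⟩ : ∃ j0, b j0 < b (j0+1) := by
    by_contra! h
    have : ∀ k, b k ≤ b 0 := by
      intro k
      induction k with
      | zero => exact le_rfl
      | succ k ih => exact (h k).trans ih
    have h1 := hbq 0
    have h2 := this (0+q)
    omega
  have hbk : ∀ k j, b (j + q * k) = b j + k := by
    intro k
    induction k with
    | zero => simp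
    | succ k ih => intro j; rw [Nat.mul_succ, ← add_assoc, hbq, ih]; push_cast; ring
  refine ⟨j0+1, fun i => ?_⟩
  have hi : j0 + 1 + i = (j0 + 1 + i % q) + q * (i / q) := by
    have := Nat.mod_add_div i q; omega
  rw [hi, hbk]
  have h1 : b (j0+1) ≤ b (j0 + 1 + i % q) := hbm (by omega)
  have h2 : b (j0 + 1 + i % q) ≤ b (j0 + q) := hbm (by have := Nat.mod_lt i hq; omega)
  have h3 := hbq j0
  have : b (j0 + 1 + i % q) = b (j0+1) := by omega
  rw [this]

lemma gb_unique (p q : ℕ) (hq : 0 < q) (z z' : ℕ → ℝ)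
    (h1 : ∀ i, 2 * z i - z (i+p) = ((i / q : ℕ) : ℝ)) (h2 : ∀ i, z (i+q) = z i + 1)
    (h1' : ∀ i, 2 * z' i - z' (i+p) = ((i / q : ℕ) : ℝ)) (h2' : ∀ i, z' (i+q) = z' i + 1) :
    z 0 = z' 0 := by
  have ha : ∀ k, z (k*p) - z' (k*p) = 2^k * (z 0 - z' 0) := by
    intro k
    induction k with
    | zero => simp
    | succ k ih =>
      have := h1 (k*p)
      have := h1' (k*p)
      rw [Nat.succ_mul, pow_succ]
      linarith
  have hb : ∀ k, z (k*q) - z' (k*q) = (z 0 - z' 0) := by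
    intro k
    induction k with
    | zero => simp
    | succ k ih => rw [Nat.succ_mul, h2, h2']; linarith
  have h3 := ha q
  rw [mul_comm, hb p] at h3
  have h4 : (1:ℝ) < 2^q := one_lt_pow₀ (by norm_num) (by omega)
  have h5 : ((2:ℝ)^q - 1) * (z 0 - z' 0) = 0 := by linarith
  rcases mul_eq_zero.1 h5 with h | h <;> linarith

lemma gb_coe_eq {x y : ℝ} (h : (x : Circle1) = (y : Circle1)) : ∃ m : ℤ, x = y + m := by
  have h0 : ((x - y : ℝ) : Circle1) = 0 := by rw [AddCircle.coe_sub, h, sub_self]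
  obtain ⟨m, hm⟩ := (AddCircle.coe_eq_zero_iff (1:ℝ)).1 h0
  refine ⟨m, ?_⟩
  simp at hm
  linarith

lemma gb_coe_int (x : ℝ) (m : ℤ) : ((x + m : ℝ) : Circle1) = (x : Circle1) := by
  have : ((m : ℝ) : Circle1) = 0 := (AddCircle.coe_eq_zero_iff (1:ℝ)).2 ⟨m, by simp⟩
  rw [AddCircle.coe_add, this, add_zero]

lemma gb_lift (C : Set Circle1) (r : ℝ) (h : IsRotationSetWith 2 C (r : Circle1)) :
    ∃ G : CircleDeg1Lift, G.translationNumber = r ∧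
      ∀ x : ℝ, (x : Circle1) ∈ C → ((G x : ℝ) : Circle1) = md 2 x := by
  obtain ⟨-, -, -, g, hg, G, hG, hr⟩ := h
  obtain ⟨m, hm⟩ := gb_coe_eq hr
  refine ⟨(CircleDeg1Lift.translate (Multiplicative.ofAdd (m:ℝ)) : CircleDeg1Lift) * G, ?_, ?_⟩
  · rw [CircleDeg1Lift.translationNumber_mul_of_commute, CircleDeg1Lift.translationNumber_translate, hm, add_comm]
    rw [CircleDeg1Lift.commute_iff_commute]
    intro x
    simp
  · intro x hx
    rw [← hg _ hx, hG]
    have := gb_coe_int (G x) m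
    rw [add_comm] at this
    simpa using this

lemma gb_bezout (p q : ℕ) (hp : 0 < p) (hq : 0 < q) (hcop : Nat.Coprime p q) :
    ∃ u w : ℕ, u * p = 1 + w * q := by
  rcases Nat.lt_or_ge 1 q with h | h
  · obtain ⟨u, hu⟩ := Nat.exists_mul_mod_eq_one_of_coprime hcop h
    refine ⟨u, p * u / q, ?_⟩
    have := Nat.mod_add_div (p*u) q
    rw [hu.2] at this
    nlinarith
  · exact ⟨1, p-1, by have : q = 1 := by omega
                      subst this; omega⟩

lemma gb_struct (p q : ℕ) (hp : 0 < p) (hq : 0 < q) (hcop : Nat.Coprime p q) (C : Set Circle1)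
    (hC : IsPeriodicOrbit 2 C) (hR : IsRotationSetWith 2 C (((p : ℝ) / (q : ℝ) : ℝ) : Circle1)) :
    C.ncard = q ∧ ∃ z : ℕ → ℝ, ((z 0 : ℝ) : Circle1) ∈ C ∧
      (∀ i, 2 * z i - z (i+p) = ((i / q : ℕ) : ℝ)) ∧ ∀ i, z (i+q) = z i + 1 := by
  obtain ⟨G, hτ, hG⟩ := gb_lift C _ hR
  have himg : md 2 '' C = C := hR.2.2.1
  have hq0 : (q:ℝ) ≠ 0 := by positivity
  have hmem : ∀ x : ℝ, (x : Circle1) ∈ C → ∀ k, ((G^[k] x : ℝ) : Circle1) = (md 2)^[k] x ∧ ((G^[k] x : ℝ) : Circle1) ∈ C := by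
    intro x hx k
    induction k with
    | zero => exact ⟨rfl, hx⟩
    | succ k ih =>
      rw [Function.iterate_succ_apply', Function.iterate_succ_apply', hG _ ih.2, ih.1]
      refine ⟨rfl, ?_⟩
      rw [← ih.1]
      exact himg.subset (mem_image_of_mem _ ih.2)
  have hper : ∀ x : ℝ, (x : Circle1) ∈ C → ∀ n, 0 < n → (md 2)^[n] (x : Circle1) = x →
      ∃ m : ℤ, G^[n] x = x + m ∧ m * (q:ℤ) = p * n := by
    intro x hx n hn hxn
    obtain ⟨m, hm⟩ := gb_coe_eq ((hmem x hx n).1.trans hxn)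
    refine ⟨m, hm, ?_⟩
    have := G.translationNumber_of_map_pow_eq_add_int (x := x) (n := n) (m := m) (by rw [CircleDeg1Lift.coe_pow]; exact hm) hn
    rw [hτ] at this
    have hn0 : (n:ℝ) ≠ 0 := by positivity
    field_simp at this
    have h2 : (m:ℝ) * q = p * n := by linarith
    exact_mod_cast h2
  obtain ⟨t, n, hn, htn, hCt⟩ := hC
  have hCn : ∀ s ∈ C, (md 2)^[n] s = s := by
    intro s hs
    rw [hCt] at hs
    obtain ⟨k, rfl⟩ := hs
    simp only
    rw [← Function.iterate_add_apply, add_comm, Function.iterate_add_apply, htn]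
  have hGq : ∀ x : ℝ, (x : Circle1) ∈ C → G^[q] x = x + p := by
    intro x hx
    obtain ⟨m, hm, hmq⟩ := hper x hx n hn (hCn _ hx)
    have h1 := (G^n).iterate_eq_of_map_eq_add_int (x := x) (m := m) (by rw [CircleDeg1Lift.coe_pow]; exact hm) q
    rw [CircleDeg1Lift.coe_pow, ← Function.iterate_mul, mul_comm, Function.iterate_mul, ← CircleDeg1Lift.coe_pow] at h1
    have h2 := ((G^q).iterate_pos_eq_iff (x := x) (m := p) hn).1 (by
      rw [h1]
      have : (m:ℝ) * q = p * n := by exact_mod_cast hmq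
      push_cast; linarith)
    rw [CircleDeg1Lift.coe_pow] at h2
    exact_mod_cast h2
  have hGqk : ∀ k, ∀ x : ℝ, (x : Circle1) ∈ C → G^[k*q] x = x + k * p := by
    intro k x hx
    induction k with
    | zero => simp
    | succ k ih =>
      rw [Nat.succ_mul, add_comm, Function.iterate_add_apply, hGq _ (hmem x hx _).2, ih]
      push_cast; ring
  have hf0 : t ∈ C := by rw [hCt]; exact ⟨⟨0, hn⟩, rfl⟩
  obtain ⟨x, rfl⟩ := QuotientAddGroup.mk_surjective t
  change ((x:ℝ) : Circle1) ∈ C at hf0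
  have hxq : (md 2)^[q] (x : Circle1) = x := by
    rw [← (hmem x hf0 q).1, hGq x hf0]
    exact_mod_cast gb_coe_int x p
  have hminper : Function.minimalPeriod (md 2) (x : Circle1) = q := by
    have hpos : 0 < Function.minimalPeriod (md 2) (x : Circle1) :=
      Function.IsPeriodicPt.minimalPeriod_pos hq hxq
    refine Nat.dvd_antisymm (Function.IsPeriodicPt.minimalPeriod_dvd hxq) ?_
    obtain ⟨m, -, hm⟩ := hper x hf0 _ hpos (Function.iterate_minimalPeriod)
    have : (q:ℤ) ∣ p * (Function.minimalPeriod (md 2) (x : Circle1) : ℕ) := ⟨m, by rw [← hm]; ring⟩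
    have : q ∣ p * (Function.minimalPeriod (md 2) (x : Circle1) : ℕ) := by exact_mod_cast this
    exact hcop.symm.dvd_of_dvd_mul_left this
  refine ⟨?_, ?_⟩
  · have : C = (fun k => (md 2)^[k] (x : Circle1)) '' (Iio q) := by
      rw [hCt]
      ext s
      constructor
      · rintro ⟨k, rfl⟩
        refine ⟨k % q, Nat.mod_lt _ hq, ?_⟩
        exact Function.IsPeriodicPt.iterate_mod_apply hxq k
      · rintro ⟨k, -, rfl⟩
        refine ⟨⟨k % n, Nat.mod_lt _ hn⟩, ?_⟩
        exact Function.IsPeriodicPt.iterate_mod_apply htn k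
    rw [this, Set.ncard_image_of_injOn]
    · simp [Set.ncard_eq_toFinset_card']
    · rw [← hminper]
      exact Function.iterate_injOn_Iio_minimalPeriod
  obtain ⟨u, w, huw⟩ := gb_bezout p q hp hq hcop
  have huwR : (u:ℝ) * p = 1 + w * q := by exact_mod_cast huw
  have hlt : ∀ x : ℝ, (x : Circle1) ∈ C → x + w < G^[u] x := by
    intro x hx
    have := ((G^u).lt_iterate_pos_iff (x := x) (m := w) hq).1 (by
      rw [CircleDeg1Lift.coe_pow, ← Function.iterate_mul, hGqk u x hx, huwR]
      push_cast; linarith)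
    rw [CircleDeg1Lift.coe_pow] at this
    exact_mod_cast this
  set y : ℕ → ℝ := fun j => G^[u*j] x - j * w with hy
  have hyC : ∀ j, ((G^[u*j] x : ℝ) : Circle1) ∈ C := fun j => (hmem x hf0 _).2
  have hb : ∀ j, ∃ b : ℤ, 2 * y j - y (j+p) = b := by
    intro j
    have h1 : G^[u * (j+p)] x = G (G^[u*j] x) + w * p := by
      rw [show u * (j+p) = w * q + (1 + u * j) by rw [mul_add, huw]; ring, Function.iterate_add_apply,
        hGqk _ _ (hmem x hf0 _).2, add_comm 1, Function.iterate_succ_apply']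
    have h2 := hG _ (hyC j)
    have h3 : md 2 ((G^[u*j] x : ℝ) : Circle1) = ((2 * G^[u*j] x : ℝ) : Circle1) := by
      simp [md, two_mul, two_nsmul]
    obtain ⟨m, hm⟩ := gb_coe_eq (h2.trans h3)
    refine ⟨-m - j * w, ?_⟩
    simp only [hy, h1, hm]
    push_cast; ring
  choose b hb using hb
  have hyq : ∀ j, y (j+q) = y j + 1 := by
    intro j
    simp only [hy]
    rw [mul_add, add_comm (u*j), Function.iterate_add_apply, hGqk _ _ (hyC j), huwR]
    push_cast; ring
  obtain ⟨j1, hj1⟩ := gb_jump p q hq y (by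
    intro j
    simp only [hy]
    rw [mul_add, mul_one, add_comm (u*j), Function.iterate_add_apply]
    have := hlt _ (hyC j)
    push_cast; linarith) hyq b hb
  refine ⟨fun i => y (j1+i) - b j1, ?_, ?_, ?_⟩
  · have : y (j1 + 0) - b j1 = G^[u*j1] x - ((j1 * w + b j1 : ℤ) : ℝ) := by
      simp only [hy]; push_cast; ring_nf
    simp only
    rw [this]
    have h := hyC j1
    have h' := gb_coe_int (G^[u*j1] x) (-(j1 * w + b j1 : ℤ))
    rw [Int.cast_neg, ← sub_eq_add_neg] at h'
    rw [h']
    exact h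
  · intro i
    have h1 := hb (j1+i)
    rw [hj1] at h1
    simp only
    rw [← add_assoc]
    rw [Int.cast_add, Int.cast_natCast] at h1
    linarith
  · intro i
    simp only
    rw [← add_assoc, hyq]; ring

def gbT (a : ℕ → ℝ) : ℕ → ℝ
  | 0 => 0
  | n+1 => 2 * gbT a n + a n

lemma gbT_shift (a : ℕ → ℝ) (n : ℕ) :
    gbT (fun k => a (k+1)) n = 2 * gbT a n - 2^n * a 0 + a n := by
  induction n with
  | zero => simp [gbT]
  | succ n ih => simp only [gbT, ih, pow_succ]; ring

lemma gbT_add_one (a : ℕ → ℝ) (n : ℕ) : gbT (fun k => a k + 1) n = gbT a n + (2^n - 1) := by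
  induction n with
  | zero => simp [gbT]
  | succ n ih => simp only [gbT, ih, pow_succ]; ring

lemma gbT_mono (a b : ℕ → ℝ) (h : ∀ k, a k ≤ b k) (n : ℕ) : gbT a n ≤ gbT b n := by
  induction n with
  | zero => simp [gbT]
  | succ n ih => simp only [gbT]; linarith [h n]

lemma gbT_strict (a b : ℕ → ℝ) (h : ∀ k, a k ≤ b k) (n k : ℕ) (hk : k < n) (hs : a k < b k) :
    gbT a n < gbT b n := by
  induction n with
  | zero => omega
  | succ n ih =>
    simp only [gbT]
    rcases Nat.lt_succ_iff_lt_or_eq.1 hk with h1 | rfl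
    · linarith [h n, ih h1]
    · linarith [gbT_mono a b h k]

lemma gb_seq (p q : ℕ) (hq : 0 < q) (hcop : Nat.Coprime p q) :
    ∃ y : ℤ → ℝ, StrictMono y ∧ (∀ i, y (i + q) = y i + 1) ∧
      ∀ i, 2 * y i - y (i + p) = ((i / (q:ℤ) : ℤ) : ℝ) := by
  have hqz : (q:ℤ) ≠ 0 := by positivity
  have hqz' : (0:ℤ) < q := by positivity
  have hD : (0:ℝ) < 2^q - 1 := by
    have : (1:ℝ) < 2^q := one_lt_pow₀ (by norm_num) (by omega)
    linarith
  set a : ℤ → ℕ → ℝ := fun i k => (((i + k * p) / (q:ℤ) : ℤ) : ℝ) with ha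
  refine ⟨fun i => (p + gbT (a i) q) / (2^q - 1), ?_, ?_, ?_⟩
  · refine strictMono_int_of_lt_succ fun i => ?_
    apply div_lt_div_of_pos_right _ hD
    obtain ⟨k, hk, hkd⟩ : ∃ k < q, (q:ℤ) ∣ i + 1 + k * p := by
      have hc : IsCoprime (p:ℤ) (q:ℤ) := Nat.isCoprime_iff_coprime.2 hcop
      obtain ⟨c, d, hcd⟩ := hc
      refine ⟨((-(i+1) * c) % (q:ℤ)).toNat, ?_, ?_⟩
      · have := Int.emod_lt_of_pos (-(i+1) * c) hqz'
        have := Int.emod_nonneg (-(i+1) * c) hqz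
        omega
      · rw [Int.toNat_of_nonneg (Int.emod_nonneg _ hqz)]
        have h1 := Int.emod_add_mul_ediv (-(i+1) * c) (q:ℤ)
        refine ⟨(i+1) * d - (-(i+1) * c / (q:ℤ)) * p, ?_⟩
        have h2 : (-(i+1) * c) % (q:ℤ) = -(i+1) * c - q * (-(i+1) * c / (q:ℤ)) := by linarith
        rw [h2]
        linear_combination (-(i+1)) * hcd
    have := gbT_strict (a i) (a (i+1)) (fun k => by
      simp only [ha]
      exact_mod_cast Int.ediv_le_ediv hqz' (by linarith)) q k hk (by
      simp only [ha]
      obtain ⟨c, hc⟩ := hkd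
      rw [hc, Int.mul_ediv_cancel_left _ hqz]
      have : (i + k * p) / (q:ℤ) < c := by
        rw [Int.ediv_lt_iff_lt_mul hqz']; linarith
      exact_mod_cast this)
    linarith
  · intro i
    have : a (i+q) = fun k => a i k + 1 := by
      funext k
      simp only [ha]
      rw [show i + (q:ℤ) + k * p = i + k * p + q by ring, Int.add_ediv_of_dvd_right (dvd_refl _),
        Int.ediv_self hqz]
      push_cast; ring
    simp only [this, gbT_add_one]
    field_simp
    ring
  · intro i
    have h1 : a (i+p) = fun k => a i (k+1) := by
      funext k
      simp only [ha]
      congr 2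
      push_cast; ring
    have h2 : a i 0 = ((i / (q:ℤ) : ℤ) : ℝ) := by simp [ha]
    have h3 : a i q = ((i / (q:ℤ) : ℤ) : ℝ) + p := by
      simp only [ha]
      rw [Int.add_mul_ediv_left _ _ hqz]
      push_cast; ring
    simp only [h1, gbT_shift, h2, h3]
    field_simp
    ring

lemma gb_ext (p q : ℕ) (hq : 0 < q) (y : ℤ → ℝ) (hy : StrictMono y)
    (hyq : ∀ i, y (i + q) = y i + 1) :
    ∃ G : CircleDeg1Lift, ∀ i, G (y i) = y (i + p) := by
  have hyk : ∀ k : ℕ, ∀ i, y (i + k * q) = y i + k := by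
    intro k
    induction k with
    | zero => simp
    | succ k ih =>
      intro i
      rw [show i + ((k+1 : ℕ) : ℤ) * q = i + k * q + q by push_cast; ring, hyq, ih]; push_cast; ring
  have hN : ∀ x : ℝ, ∃ N : ℤ, ∀ j, y j ≤ x ↔ j ≤ N := by
    intro x
    have h1 : ∃ b : ℤ, ∀ z : ℤ, y z ≤ x → z ≤ b := by
      obtain ⟨k, hk⟩ := exists_nat_gt (x - y 0)
      refine ⟨0 + k * q, fun z hz => ?_⟩
      by_contra! h
      have := hy h
      rw [hyk] at this
      linarith
    have h2 : ∃ z : ℤ, y z ≤ x := by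
      obtain ⟨k, hk⟩ := exists_nat_gt (y 0 - x)
      refine ⟨0 - k * q, ?_⟩
      have := hyk k (0 - k * q)
      rw [sub_add_cancel] at this
      linarith
    obtain ⟨N, hN1, hN2⟩ := Int.exists_greatest_of_bdd h1 h2
    exact ⟨N, fun j => ⟨hN2 j, fun h => (hy.monotone h).trans hN1⟩⟩
  choose N hN using hN
  refine ⟨⟨⟨fun x => y (N x + p), ?_⟩, ?_⟩, ?_⟩
  · intro x x' h
    apply hy.monotone
    have : N x ≤ N x' := (hN x' _).1 (((hN x _).2 le_rfl).trans h)
    omega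
  · intro x
    have h : N (x+1) = N x + q := by
      apply le_antisymm
      · have := (hN (x+1) _).2 le_rfl
        rw [← sub_add_cancel (N (x+1)) (q:ℤ), hyq] at this
        have := (hN x _).1 (by linarith : y (N (x+1) - q) ≤ x)
        omega
      · apply (hN (x+1) _).1
        rw [hyq]
        have := (hN x _).2 le_rfl
        linarith
    change y (N (x+1) + p) = y (N x + p) + 1
    rw [h, ← hyq]; congr 1; ring
  · intro i
    change y (N (y i) + p) = y (i + p)
    have : N (y i) = i := by
      apply le_antisymm
      · exact hy.le_iff_le.1 ((hN (y i) _).2 le_rfl)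
      · exact (hN (y i) _).1 le_rfl
    rw [this]

lemma gb_cycle_img (t : Circle1) (n : ℕ) (hn : 0 < n) (ht : (md 2)^[n] t = t) :
    Set.range (fun k : Fin n => (md 2)^[(k : ℕ)] t) = Set.range (fun k : ℕ => (md 2)^[k] t) := by
  ext s
  constructor
  · rintro ⟨k, rfl⟩
    exact ⟨k, rfl⟩
  · rintro ⟨k, rfl⟩
    exact ⟨⟨k % n, Nat.mod_lt _ hn⟩, Function.IsPeriodicPt.iterate_mod_apply ht k⟩

lemma gb_exists (p q : ℕ) (hq : 0 < q) (hcop : Nat.Coprime p q) :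
    ∃ C : Set Circle1, IsPeriodicOrbit 2 C ∧
        IsRotationSetWith 2 C ((((p : ℝ) / (q : ℝ)) : ℝ) : Circle1) := by
  obtain ⟨y, hy, hyq, hyp⟩ := gb_seq p q hq hcop
  obtain ⟨G, hG⟩ := gb_ext p q hq y hy hyq
  have hmd : ∀ i, md 2 ((y i : ℝ) : Circle1) = ((y (i+p) : ℝ) : Circle1) := by
    intro i
    have h3 : md 2 ((y i : ℝ) : Circle1) = ((2 * y i : ℝ) : Circle1) := by
      simp [md, two_mul, two_nsmul]
    rw [h3, ← gb_coe_int (y (i+p)) (i / (q:ℤ)), ← hyp i]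
    congr 1; ring
  have hit : ∀ k : ℕ, (md 2)^[k] ((y 0 : ℝ) : Circle1) = ((y (k * p) : ℝ) : Circle1) := by
    intro k
    induction k with
    | zero => simp
    | succ k ih => rw [Function.iterate_succ_apply', ih, hmd]; congr 2; push_cast; ring
  have hGit : ∀ k : ℕ, G^[k] (y 0) = y (k * p) := by
    intro k
    induction k with
    | zero => simp
    | succ k ih => rw [Function.iterate_succ_apply', ih, hG]; congr 1; push_cast; ring
  have hyk : ∀ k : ℕ, y (k * q) = y 0 + k := by
    intro k
    induction k with
    | zero => simp
    | succ k ih =>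
      rw [show ((k+1 : ℕ) : ℤ) * q = k * q + q by push_cast; ring, hyq, ih]; push_cast; ring
  have hper : (md 2)^[q] ((y 0 : ℝ) : Circle1) = ((y 0 : ℝ) : Circle1) := by
    rw [hit, mul_comm, hyk]
    exact_mod_cast gb_coe_int (y 0) p
  refine ⟨_, ⟨((y 0 : ℝ) : Circle1), q, hq, hper, rfl⟩, ?_, ?_, ?_, ?_⟩
  · exact ⟨_, ⟨⟨0, hq⟩, rfl⟩⟩
  · exact (Set.finite_range _).isCompact
  · rw [gb_cycle_img _ _ hq hper]
    ext s
    constructor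
    · rintro ⟨_, ⟨k, rfl⟩, rfl⟩
      exact ⟨k+1, Function.iterate_succ_apply' _ _ _⟩
    · rintro ⟨k, rfl⟩
      refine ⟨_, ⟨k + (q-1), rfl⟩, ?_⟩
      simp only
      rw [← Function.iterate_succ_apply' (md 2), show (k + (q-1)).succ = k + q by omega,
        Function.iterate_add_apply, hper]
  · have hlift : IsLift (fun t => ((G (AddCircle.equivIco 1 0 t : ℝ) : ℝ) : Circle1)) G := by
      intro x
      have h1 : (((AddCircle.equivIco 1 0 (x : Circle1) : ℝ)) : Circle1) = (x : Circle1) :=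
        (AddCircle.equivIco (1:ℝ) 0).symm_apply_apply (x : Circle1)
      obtain ⟨m, hm⟩ := gb_coe_eq h1
      simp only
      rw [hm, G.map_add_int, gb_coe_int]
    refine ⟨fun t => ((G (AddCircle.equivIco 1 0 t : ℝ) : ℝ) : Circle1), ?_, G, hlift, ?_⟩
    · rintro _ ⟨k, rfl⟩
      simp only [hit]
      exact (hlift _).trans (by rw [hG, hmd])
    · congr 1
      symm
      have := G.translationNumber_of_map_pow_eq_add_int (x := y 0) (n := q) (m := p) (by
        rw [CircleDeg1Lift.coe_pow, hGit, mul_comm, hyk]; push_cast; rfl) hq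
      rw [this, Int.cast_natCast]

lemma gb_orbit_eq (C C' : Set Circle1) (h : IsPeriodicOrbit 2 C) (h' : IsPeriodicOrbit 2 C')
    (s : Circle1) (hs : s ∈ C) (hs' : s ∈ C') : C = C' := by
  have key : ∀ C : Set Circle1, IsPeriodicOrbit 2 C → s ∈ C →
      C = Set.range (fun k : ℕ => (md 2)^[k] s) := by
    rintro C ⟨t, n, hn, ht, rfl⟩ hs
    obtain ⟨k, rfl⟩ := hs
    rw [gb_cycle_img _ _ hn ht]
    ext r
    constructor
    · rintro ⟨j, rfl⟩
      refine ⟨j + (n - k), ?_⟩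
      simp only
      rw [← Function.iterate_add_apply, show j + (n - (k:ℕ)) + k = j + n by omega,
        Function.iterate_add_apply, ht]
    · rintro ⟨j, rfl⟩
      exact ⟨j + k, Function.iterate_add_apply _ _ _ _⟩
  rw [key C h hs, key C' h' hs']

/-- Goldberg's theorem for `m_2`. For a reduced fraction `p/q` there is
exactly one periodic orbit of `m_2` which is a rotation set for `m_2` with rotation number
`p/q`; moreover it has exactly `q` elements. -/
theorem goldberg_m2
    (p q : ℕ) (hq : 1 ≤ q) (hpq : p < q) (hcop : Nat.Coprime p q) :
    (∃! C : Set Circle1, IsPeriodicOrbit 2 C ∧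
        IsRotationSetWith 2 C ((((p : ℝ) / (q : ℝ)) : ℝ) : Circle1)) ∧
    ∀ C : Set Circle1, IsPeriodicOrbit 2 C →
      IsRotationSetWith 2 C ((((p : ℝ) / (q : ℝ)) : ℝ) : Circle1) →
      C.ncard = q := by
  have hr : ((((p : ℝ) / (q : ℝ)) : ℝ) : Circle1) = (((((p+q : ℕ) : ℝ)) / (q : ℝ) : ℝ) : Circle1) := by
    have hq0 : (q:ℝ) ≠ 0 := by positivity
    have h := gb_coe_int ((p:ℝ)/q) 1
    rw [← h]
    congr 1
    push_cast
    field_simp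
  have hcop' : Nat.Coprime (p+q) q := by simpa using hcop
  rw [hr]
  have hst := gb_struct (p+q) q (by omega) (by omega) hcop'
  refine ⟨?_, fun C hC hR => (hst C hC hR).1⟩
  obtain ⟨C, hC, hR⟩ := gb_exists (p+q) q (by omega) hcop'
  refine ⟨C, ⟨hC, hR⟩, ?_⟩
  rintro C' ⟨hC', hR'⟩
  obtain ⟨-, z, hz, hz1, hz2⟩ := hst C hC hR
  obtain ⟨-, z', hz', hz1', hz2'⟩ := hst C' hC' hR'
  have := gb_unique (p+q) q (by omega) z z' hz1 hz2 hz1' hz2'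
  rw [← this] at hz'
  exact gb_orbit_eq C' C hC' hC _ hz' hz
end
end
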